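/- Let a, b > 0, α ∈ ℝ, and let k > |α| be such that sin(a·k) ≠ 0 and sin(b·k) ≠ 0. Then the gap condition GC2, i.e. 1/|sin(a·k)| − 2/|sin(b·k)| > |cot(a·k) + 2·cot(b·k) + α/k|, holds if and only if all four of the following conditions hold: 1/|sin(a·k)| > 2/|sin(b·k)|, cot(a·k)·cot(b·k) < 0, α·cot(a·k) < 0, and |G(k) − |α|/k| < 1/|sin(a·k)| − 2/|sin(b·k)|, where G(k) = |cot(a·k)| − 2·|cot(b·k)|. -/

import Mathlib

open Real

theorem Real.one_div_abs_sin_sq {x : ℝ} (hx : sin x ≠ 0) :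
    (1 / |sin x|) ^ 2 = 1 + cot x ^ 2 := by
  rw [cot_eq_cos_div_sin, div_pow, div_pow, sq_abs]
  field_simp
  linarith [sin_sq_add_cos_sq x]

/-- For `s = √(1 + x²)` and `t = √(1 + y²)` with `x` nonnegative, `s - x > 2 * (t + y) + e`
forces both `y` and `e` to be negative, as soon as `s > 2 * t` and `e > -1`. -/
theorem neg_and_neg_of_add_lt_sub {s t x y e : ℝ} (ht : 0 < t) (hs2 : s ^ 2 = 1 + x ^ 2)
    (ht2 : t ^ 2 = 1 + y ^ 2) (hx : 0 ≤ x) (he : -1 < e) (hst : 2 * t < s)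
    (h : x + 2 * y + e < s - 2 * t) : y < 0 ∧ e < 0 := by
  have ht1 : 1 ≤ t := by nlinarith [sq_nonneg y]
  have hxy : 2 * |y| < x := by
    refine lt_of_pow_lt_pow_left₀ 2 hx ?_
    rw [mul_pow, sq_abs]
    nlinarith
  have hprod : (s - x) * (s + x) = 1 := by linear_combination hs2
  constructor
  · by_contra! hy
    have hsx : s - x ≤ 1 := by nlinarith
    linarith
  · by_contra! he0
    have hyt : (t + y) * (t - y) = 1 := by linear_combination ht2
    have hyle := neg_abs_le y
    have hty : 0 < t + y := by
      linarith [abs_lt_of_sq_lt_sq (show y ^ 2 < t ^ 2 by linarith) ht.le]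
    have h₁ : 2 * (t - y) < s + x := by linarith
    have h₂ : 2 * (t + y) < s - x := by linarith
    nlinarith

/-- For `k > |α|`, the gap condition GC2 holds iff `1/|sin(a·k)| > 2/|sin(b·k)|`,
`cot(a·k)·cot(b·k) < 0`, `α·cot(a·k) < 0`, and
`| G(k) − |α|/k | < 1/|sin(a·k)| − 2/|sin(b·k)|` with `G(k) = |cot(a·k)| − 2·|cot(b·k)|`. -/
theorem GC2_characterization (a b k α : ℝ) (ha : 0 < a) (hb : 0 < b)
    (hk : k > |α|) (hsa : Real.sin (a * k) ≠ 0) (hsb : Real.sin (b * k) ≠ 0) :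
    (1 / |Real.sin (a * k)| - 2 / |Real.sin (b * k)|
        > |Real.cot (a * k) + 2 * Real.cot (b * k) + α / k|)
    ↔ (1 / |Real.sin (a * k)| > 2 / |Real.sin (b * k)| ∧
       Real.cot (a * k) * Real.cot (b * k) < 0 ∧
       α * Real.cot (a * k) < 0 ∧
       |(|Real.cot (a * k)| - 2 * |Real.cot (b * k)|) - |α| / k|
         < 1 / |Real.sin (a * k)| - 2 / |Real.sin (b * k)|) := by
  have hsx := one_div_abs_sin_sq hsa
  have hty := one_div_abs_sin_sq hsb
  have ht : 0 < 1 / |sin (b * k)| := by positivity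
  have hk0 : 0 < k := (abs_nonneg α).trans_lt hk
  have he : |α / k| < 1 := by rwa [abs_div, abs_of_pos hk0, div_lt_one hk0]
  have habs : |α| / k = |α / k| := by rw [abs_div, abs_of_pos hk0]
  have hsign : α * cot (a * k) < 0 ↔ α / k * cot (a * k) < 0 := by
    rw [div_mul_eq_mul_div, div_lt_iff₀ hk0, zero_mul]
  rw [habs, hsign, show 2 / |sin (b * k)| = 2 * (1 / |sin (b * k)|) by ring]
  generalize 1 / |sin (a * k)| = s at *
  generalize 1 / |sin (b * k)| = t at *
  generalize cot (a * k) = x at *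
  generalize cot (b * k) = y at *
  generalize α / k = e at *
  have hsigned : x * y < 0 → e * x < 0 → |x + 2 * y + e| = abs (|x| - 2 * |y| - abs e) := by
    intro hxy hex
    rcases mul_neg_iff.mp hxy with ⟨hx, hy⟩ | ⟨hx, hy⟩
    · have he : e < 0 := by nlinarith
      rw [abs_of_pos hx, abs_of_neg hy, abs_of_neg he]
      ring_nf
    · have he : 0 < e := by nlinarith
      rw [abs_of_neg hx, abs_of_pos hy, abs_of_pos he, ← abs_neg]
      ring_nf
  constructor
  · intro h
    have hst : 2 * t < s := by linarith [abs_nonneg (x + 2 * y + e)]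
    have hx0 : x ≠ 0 := by
      rintro rfl
      nlinarith [sq_nonneg y]
    obtain ⟨he₁, he₂⟩ := abs_lt.mp he
    obtain ⟨h₁, h₂⟩ := abs_lt.mp h
    have hneg : x * y < 0 ∧ e * x < 0 := by
      rcases hx0.lt_or_gt with hx | hx
      · obtain ⟨hy, he⟩ := neg_and_neg_of_add_lt_sub (x := -x) (y := -y) (e := -e) ht
          (by rwa [neg_sq]) (by rwa [neg_sq]) (by linarith) (by linarith) hst (by linarith)
        exact ⟨mul_neg_of_neg_of_pos hx (by linarith), mul_neg_of_pos_of_neg (by linarith) hx⟩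
      · obtain ⟨hy, he⟩ := neg_and_neg_of_add_lt_sub ht hsx hty hx.le he₁ hst h₂
        exact ⟨mul_neg_of_pos_of_neg hx hy, mul_neg_of_neg_of_pos he hx⟩
    exact ⟨hst, hneg.1, hneg.2, hsigned hneg.1 hneg.2 ▸ h⟩
  · rintro ⟨-, hxy, hex, h⟩
    rwa [gt_iff_lt, hsigned hxy hex]
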